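/- (Converse of Pillai's theorem for continued fractions) Let x ∈ (0,1). If for every finite string s of positive integers, lim_{n→∞} |{i : 0 ≤ i ≤ n, T^i x ∈ C_s}|/n = γ(C_s), then for every finite string t of positive integers of length m, lim_{n→∞} |{i : 0 ≤ i ≤ n/m, T^{mi} x ∈ C_t}|/(n/m) = γ(C_t). -/

import Mathlib

open MeasureTheory Filter

noncomputable def gaussMap (x : ℝ) : ℝ := Int.fract x⁻¹

noncomputable def gaussMeasure : Measure ℝ :=
  (volume.restrict (Set.Ioo (0:ℝ) 1)).withDensity
    (fun x => ENNReal.ofReal (1 / ((1 + x) * Real.log 2)))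

noncomputable def cfDigit (x : ℝ) (i : ℕ) : ℕ := ⌊(gaussMap^[i] x)⁻¹⌋₊

def cylinder (w : List ℕ) : Set ℝ :=
  {x | x ∈ Set.Ioo (0:ℝ) 1 ∧ ∀ i < w.length, cfDigit x i = w.getD i 0}

noncomputable def blockCount (x : ℝ) (m : ℕ) (s : List ℕ) (N : ℕ) : ℕ :=
  Nat.card {i : ℕ // i ≤ N ∧ (gaussMap^[m * i] x) ∈ cylinder s}

def CFNormal (x : ℝ) : Prop :=
  ∀ s : List ℕ, s ≠ [] → (∀ a ∈ s, 0 < a) →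
    Tendsto (fun n : ℕ => (blockCount x 1 s n : ℝ) / n) atTop
      (nhds (gaussMeasure (cylinder s)).toReal)

def cfVal : List ℕ → ℚ
  | [] => 0
  | a :: t => 1 / (a + cfVal t)

def cfQ (a : ℕ → ℕ) : ℕ → ℕ
  | 0 => 0
  | 1 => 1
  | (m+2) => a (m+1) * cfQ a (m+1) + cfQ a m

def cfP (a : ℕ → ℕ) : ℕ → ℕ
  | 0 => 1
  | 1 => 0
  | (m+2) => a (m+1) * cfP a (m+1) + cfP a m

/-- `u n` is asymptotically at most `a * n`. -/
def EventuallyLeLinear (u : ℕ → ℝ) (a : ℝ) : Prop :=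
  ∀ δ > 0, ∀ᶠ n : ℕ in atTop, u n ≤ n * (a + δ)

theorem EventuallyLeLinear.add {u v : ℕ → ℝ} {a b : ℝ} (hu : EventuallyLeLinear u a)
    (hv : EventuallyLeLinear v b) : EventuallyLeLinear (fun n => u n + v n) (a + b) := by
  intro δ hδ
  filter_upwards [hu (δ / 2) (by positivity), hv (δ / 2) (by positivity)] with n h1 h2
  linarith

theorem EventuallyLeLinear.mono {u v : ℕ → ℝ} {a b : ℝ} (hu : EventuallyLeLinear u a)
    (hvu : ∀ n, v n ≤ u n) (hab : a ≤ b) : EventuallyLeLinear v b := by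
  intro δ hδ
  filter_upwards [hu δ hδ] with n h1
  exact (hvu n).trans (h1.trans (by gcongr))

theorem EventuallyLeLinear.of_tendsto {u : ℕ → ℝ} {a : ℝ}
    (hu : Tendsto (fun n : ℕ => u n / n) atTop (nhds a)) : EventuallyLeLinear u a := by
  intro δ hδ
  filter_upwards [hu.eventually_lt_const (lt_add_of_pos_right a hδ), eventually_gt_atTop 0]
    with n h1 h2
  rw [div_lt_iff₀ (by positivity)] at h1
  linarith

theorem EventuallyLeLinear.sum {ι : Type*} (s : Finset ι) {u : ι → ℕ → ℝ} {a : ι → ℝ}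
    (hu : ∀ i ∈ s, EventuallyLeLinear (u i) (a i)) :
    EventuallyLeLinear (fun n => ∑ i ∈ s, u i n) (∑ i ∈ s, a i) := by
  classical
  induction s using Finset.induction_on with
  | empty => exact .of_tendsto (by simp)
  | insert i s hi ih =>
    simp only [Finset.sum_insert hi]
    exact (hu i (by simp)).add (ih fun j hj => hu j (by simp [hj]))

theorem abs_sum_range_shift_sub_le {e : ℕ → ℝ} (he : ∀ j, |e j| ≤ 1) (s n : ℕ) :
    |∑ j ∈ Finset.range n, e (j + s) - ∑ j ∈ Finset.range n, e j| ≤ 2 * s := by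
  induction s with
  | zero => simp
  | succ s ih =>
    have h1 := Finset.sum_range_succ (fun j => e (j + s)) n
    have h2 := Finset.sum_range_succ' (fun j => e (j + s)) n
    simp only [zero_add, add_right_comm _ 1 s] at h2
    have h3 := abs_le.1 (he (n + s))
    have h4 := abs_le.1 (he s)
    rw [abs_le] at ih ⊢
    push_cast
    simp only [add_assoc] at *
    constructor <;> linarith [ih.1, ih.2, h3.1, h3.2, h4.1, h4.2]

theorem EventuallyLeLinear.shift {e : ℕ → ℝ} (he : ∀ j, |e j| ≤ 1) {a : ℝ} (s : ℕ)
    (h : EventuallyLeLinear (fun n => ∑ j ∈ Finset.range n, e j) a) :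
    EventuallyLeLinear (fun n => ∑ j ∈ Finset.range n, e (j + s)) a := by
  have h1 : EventuallyLeLinear (fun _ : ℕ => (2 * s : ℝ)) 0 :=
    .of_tendsto (tendsto_const_div_atTop_nhds_zero_nat _)
  refine (h.add h1).mono (fun n => ?_) (by simp)
  linarith [(abs_le.1 (abs_sum_range_shift_sub_le he s n)).2]

/-- A linear bound, in mean, for the squares of sums of a sequence with decaying correlations. -/
theorem eventuallyLeLinear_sum_sq {c : ℕ → ℝ} (hc : ∀ j, |c j| ≤ 1) {m : ℕ} {ε : ℕ → ℝ} {M : ℝ}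
    (hM : ∀ K, ∑ d ∈ Finset.range K, ε d ≤ M)
    (hcorr : ∀ d, EventuallyLeLinear
      (fun n => ∑ j ∈ Finset.range n, c j * c (j + m * d)) (ε d)) (K : ℕ) :
    EventuallyLeLinear
      (fun n => ∑ j ∈ Finset.range n, (∑ k ∈ Finset.range K, c (j + m * k)) ^ 2)
      (2 * M * K) := by
  induction K with
  | zero => exact .of_tendsto (by simp)
  | succ K ih =>
    have hcc : ∀ d j, |c j * c (j + m * d)| ≤ 1 := fun d j => by
      rw [abs_mul]; exact mul_le_one₀ (hc _) (abs_nonneg _) (hc _)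
    have h1 : EventuallyLeLinear (fun n => ∑ k ∈ Finset.range (K + 1),
        ∑ j ∈ Finset.range n, c (j + m * k) * c (j + m * K)) M := by
      refine (EventuallyLeLinear.sum (Finset.range (K + 1)) (a := fun k => ε (K - k))
        fun k hk => ?_).mono (fun n => le_rfl) ?_
      · have hk' : k + (K - k) = K := by
          have := Finset.mem_range.1 hk
          omega
        refine ((hcorr (K - k)).shift (hcc _) (m * k)).mono (fun n => le_of_eq ?_) le_rfl
        refine Finset.sum_congr rfl fun j _ => ?_
        rw [add_assoc, ← mul_add, hk']
      · have := Finset.sum_range_reflect ε (K + 1)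
        simp only [Nat.add_sub_cancel] at this
        rw [this]
        exact hM _
    refine (ih.add (h1.add h1)).mono (fun n => ?_) (by push_cast; linarith)
    simp only [Finset.sum_comm (s := Finset.range (K + 1)), ← Finset.sum_add_distrib]
    refine Finset.sum_le_sum fun j _ => ?_
    rw [Finset.sum_add_distrib, ← Finset.sum_mul, Finset.sum_range_succ]
    nlinarith [sq_nonneg (c (j + m * K))]

theorem sum_range_mul_le_sum_range {Q : ℕ → ℝ} (hQ : ∀ j, 0 ≤ Q j) {m : ℕ} (hm : 0 < m) (N : ℕ) :
    ∑ i ∈ Finset.range N, Q (m * i) ≤ ∑ j ∈ Finset.range (m * N), Q j := by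
  induction N with
  | zero => simp
  | succ N ih =>
    rw [Finset.sum_range_succ, mul_add, mul_one, Finset.sum_range_add]
    refine add_le_add ih ?_
    exact Finset.single_le_sum (f := fun r => Q (m * N + r)) (fun r _ => hQ _)
      (Finset.mem_range.2 hm)

/-- If the correlations of a bounded sequence along multiples of `m` have bounded partial sums,
then its averages along multiples of `m` vanish. -/
theorem tendsto_average_mul_zero {c : ℕ → ℝ} (hc : ∀ j, |c j| ≤ 1) {m : ℕ} (hm : 0 < m)
    {ε : ℕ → ℝ} {M : ℝ} (hM : ∀ K, ∑ d ∈ Finset.range K, ε d ≤ M)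
    (hcorr : ∀ d, EventuallyLeLinear
      (fun n => ∑ j ∈ Finset.range n, c j * c (j + m * d)) (ε d)) :
    Tendsto (fun N : ℕ => (∑ i ∈ Finset.range N, c (m * i)) / N) atTop (nhds 0) := by
  have hM0 : 0 ≤ M := by simpa using hM 0
  rw [Metric.tendsto_nhds]
  intro η hη
  obtain ⟨K, hK⟩ := exists_nat_gt (m * (2 * M + 1) / (η / 2) ^ 2)
  have hm' : (0 : ℝ) < m := by exact_mod_cast hm
  have hK0 : (0 : ℝ) < K := lt_of_le_of_lt (by positivity) hK
  have hK1 : (1 : ℝ) ≤ K := by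
    have : 0 < K := by exact_mod_cast hK0
    exact_mod_cast this
  rw [div_lt_iff₀ (by positivity)] at hK
  have hsq := (tendsto_id.const_mul_atTop' hm).eventually
    (eventuallyLeLinear_sum_sq hc hM hcorr K 1 one_pos)
  obtain ⟨N₀, hN₀⟩ := exists_nat_gt (4 * K / η)
  filter_upwards [hsq, eventually_ge_atTop N₀] with N h1 h2
  have hN : 4 * K / η < N := lt_of_lt_of_le hN₀ (by exact_mod_cast h2)
  have hN0 : (0 : ℝ) < N := lt_of_le_of_lt (by positivity) hN
  rw [div_lt_iff₀ hη] at hN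
  set A := ∑ i ∈ Finset.range N, c (m * i)
  set S := ∑ i ∈ Finset.range N, ∑ k ∈ Finset.range K, c (m * i + m * k) with hS
  have hS2 : S ^ 2 ≤ (N * K * (η / 2)) ^ 2 := by
    have h3 : S ^ 2 ≤ N * ∑ i ∈ Finset.range N,
        (∑ k ∈ Finset.range K, c (m * i + m * k)) ^ 2 := by
      simpa using sq_sum_le_card_mul_sum_sq (s := Finset.range N)
        (f := fun i => ∑ k ∈ Finset.range K, c (m * i + m * k))
    have h4 := sum_range_mul_le_sum_range
      (Q := fun j => (∑ k ∈ Finset.range K, c (j + m * k)) ^ 2) (fun j => sq_nonneg _) hm N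
    simp only [id, Nat.cast_mul] at h1
    have h5 : (m : ℝ) * N * (2 * M * K + 1) ≤ N * (K * (K * (η / 2) ^ 2)) := by
      have h6 : (m : ℝ) * (2 * M * K + 1) ≤ K * (m * (2 * M + 1)) := by nlinarith
      calc (m : ℝ) * N * (2 * M * K + 1) = N * (m * (2 * M * K + 1)) := by ring
        _ ≤ N * (K * (m * (2 * M + 1))) := by gcongr
        _ ≤ _ := by gcongr
    calc S ^ 2 ≤ N * (N * (K * (K * (η / 2) ^ 2))) :=
          h3.trans (by gcongr; exact h4.trans (h1.trans h5))
      _ = _ := by ring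
  have hS3 : |S| ≤ N * K * (η / 2) := abs_le_of_sq_le_sq hS2 (by positivity)
  have hKA : |S - K * A| ≤ 2 * K * K := by
    have : S - K * A = ∑ k ∈ Finset.range K, (∑ i ∈ Finset.range N, c (m * (i + k)) - A) := by
      rw [hS, Finset.sum_comm, Finset.sum_sub_distrib]
      simp [mul_add]
    rw [this]
    calc _ ≤ ∑ k ∈ Finset.range K, |∑ i ∈ Finset.range N, c (m * (i + k)) - A| :=
          Finset.abs_sum_le_sum_abs _ _
      _ ≤ ∑ k ∈ Finset.range K, (2 * K : ℝ) := by
          refine Finset.sum_le_sum fun k hk => ?_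
          refine (abs_sum_range_shift_sub_le (e := fun i => c (m * i)) (fun j => hc _) k N).trans ?_
          have : (k : ℝ) ≤ K := by exact_mod_cast (Finset.mem_range.1 hk).le
          linarith
      _ = 2 * K * K := by simp; ring
  have hKA2 : K * |A| < K * (N * η) := by
    have h7 : K * |A| = |K * A| := by rw [abs_mul, abs_of_pos hK0]
    have h8 : |(K : ℝ) * A| ≤ |S| + |S - K * A| := by
      have := abs_sub_abs_le_abs_sub (K * A) S
      rw [abs_sub_comm] at this
      linarith
    rw [h7]
    nlinarith
  rw [Real.dist_eq, sub_zero, abs_div, abs_of_pos hN0, div_lt_iff₀ hN0]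
  linarith [lt_of_mul_lt_mul_left hKA2 hK0.le]

/-- The conditional probability, given the future `x`, that the preceding digit is `i + 1`. -/
noncomputable def gaussWeight (i : ℕ) (x : ℝ) : ℝ := (x + 1) / ((x + i + 1) * (x + i + 2))

/-- The transfer operator of the Gauss map with respect to the Gauss measure. -/
noncomputable def gaussTransfer (f : ℝ → ℝ) (x : ℝ) : ℝ :=
  ∑' i : ℕ, gaussWeight i x * f (x + i + 1)⁻¹

theorem gaussWeight_nonneg (i : ℕ) {x : ℝ} (hx : 0 ≤ x) : 0 ≤ gaussWeight i x := by
  unfold gaussWeight; positivity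

theorem measurable_gaussWeight (i : ℕ) : Measurable (gaussWeight i) := by
  unfold gaussWeight; fun_prop

theorem sum_range_gaussWeight {x : ℝ} (hx : 0 ≤ x) (n : ℕ) :
    ∑ i ∈ Finset.range n, gaussWeight i x = n / (x + n + 1) := by
  induction n with
  | zero => simp
  | succ n ih =>
    rw [Finset.sum_range_succ, ih, gaussWeight]
    push_cast
    have h1 : x + n + 1 ≠ 0 := by positivity
    have h2 : x + n + 2 ≠ 0 := by positivity
    have h3 : x + (n + 1) + 1 ≠ 0 := by positivity
    field_simp
    ring

theorem hasSum_gaussWeight {x : ℝ} (hx : 0 ≤ x) : HasSum (fun i => gaussWeight i x) 1 := by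
  rw [hasSum_iff_tendsto_nat_of_nonneg fun i => gaussWeight_nonneg i hx]
  simp only [sum_range_gaussWeight hx]
  have := tendsto_natCast_div_add_atTop (x + 1)
  refine this.congr fun n => ?_
  ring_nf

theorem summable_gaussWeight_mul {x : ℝ} (hx : 0 ≤ x) {a : ℕ → ℝ} (ha : ∀ i, a i ∈ Set.Icc 0 1) :
    Summable fun i => gaussWeight i x * a i :=
  Summable.of_nonneg_of_le (fun i => mul_nonneg (gaussWeight_nonneg i hx) (ha i).1)
    (fun i => mul_le_of_le_one_right (gaussWeight_nonneg i hx) (ha i).2)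
    (hasSum_gaussWeight hx).summable

theorem tsum_gaussWeight_le_of_antitone {x y : ℝ} (hx : 0 ≤ x) (hxy : x ≤ y) {a : ℕ → ℝ}
    (ha : ∀ i, a i ∈ Set.Icc 0 1) (hanti : Antitone a) :
    ∑' i, gaussWeight i y * a i ≤ ∑' i, gaussWeight i x * a i := by
  have hy := hx.trans hxy
  have hS : ∀ n : ℕ, (n : ℝ) / (y + n + 1) ≤ n / (x + n + 1) := fun n => by gcongr
  have key : ∀ n : ℕ, ∑ i ∈ Finset.range n, gaussWeight i y * a i +
      (n / (x + n + 1) - n / (y + n + 1)) * a n ≤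
        ∑ i ∈ Finset.range n, gaussWeight i x * a i := by
    intro n
    induction n with
    | zero => simp
    | succ n ih =>
      rw [Finset.sum_range_succ, Finset.sum_range_succ]
      have hx1 := sum_range_gaussWeight hx (n + 1)
      have hy1 := sum_range_gaussWeight hy (n + 1)
      rw [Finset.sum_range_succ, sum_range_gaussWeight hx] at hx1
      rw [Finset.sum_range_succ, sum_range_gaussWeight hy] at hy1
      have h1 := mul_le_mul_of_nonneg_left (hanti (Nat.le_succ n)) (sub_nonneg.2 (hS (n + 1)))
      rw [← hx1, ← hy1] at h1 ⊢
      simp only [Nat.succ_eq_add_one] at h1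
      linarith
  refine le_of_tendsto_of_tendsto' (summable_gaussWeight_mul hy ha).hasSum.tendsto_sum_nat
    (summable_gaussWeight_mul hx ha).hasSum.tendsto_sum_nat fun n => ?_
  refine le_trans ?_ (key n)
  exact le_add_of_nonneg_right (mul_nonneg (sub_nonneg.2 (hS n)) (ha n).1)

theorem inv_branch_mem_Icc {x : ℝ} (hx : 0 ≤ x) (i : ℕ) : (x + i + 1)⁻¹ ∈ Set.Icc (0 : ℝ) 1 := by
  refine ⟨by positivity, inv_le_one_of_one_le₀ ?_⟩
  have : (0 : ℝ) ≤ i := by positivity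
  linarith

theorem gaussTransfer_one_sub {f : ℝ → ℝ} (hf : ∀ x ∈ Set.Icc (0 : ℝ) 1, f x ∈ Set.Icc (0 : ℝ) 1)
    {x : ℝ} (hx : 0 ≤ x) : gaussTransfer (fun y => 1 - f y) x = 1 - gaussTransfer f x := by
  have h := (hasSum_gaussWeight hx).sub
    (summable_gaussWeight_mul hx fun i => hf _ (inv_branch_mem_Icc hx i)).hasSum
  simpa only [gaussTransfer, mul_sub, mul_one] using h.tsum_eq

theorem gaussTransfer_mem_Icc {f : ℝ → ℝ} (hf : ∀ x ∈ Set.Icc (0 : ℝ) 1, f x ∈ Set.Icc (0 : ℝ) 1)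
    {x : ℝ} (hx : 0 ≤ x) : gaussTransfer f x ∈ Set.Icc (0 : ℝ) 1 := by
  have h : ∀ g : ℝ → ℝ, (∀ x ∈ Set.Icc (0 : ℝ) 1, g x ∈ Set.Icc (0 : ℝ) 1) →
      0 ≤ gaussTransfer g x := fun g hg =>
    tsum_nonneg fun i => mul_nonneg (gaussWeight_nonneg i hx) (hg _ (inv_branch_mem_Icc hx i)).1
  have h2 := h (fun y => 1 - f y) fun y hy => Set.Icc.mem_iff_one_sub_mem.1 (hf y hy)
  rw [gaussTransfer_one_sub hf hx] at h2
  exact ⟨h f hf, by linarith⟩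

theorem antitoneOn_gaussTransfer {f : ℝ → ℝ}
    (hf : ∀ x ∈ Set.Icc (0 : ℝ) 1, f x ∈ Set.Icc (0 : ℝ) 1)
    (hmono : MonotoneOn f (Set.Icc 0 1)) : AntitoneOn (gaussTransfer f) (Set.Icc 0 1) := by
  intro x hx y hy hxy
  have hx0 : 0 ≤ x := hx.1
  have hb := fun (z : ℝ) (hz : z ∈ Set.Icc (0 : ℝ) 1) (i : ℕ) => inv_branch_mem_Icc hz.1 i
  refine (tsum_gaussWeight_le_of_antitone hx.1 hxy (fun i => hf _ (hb y hy i)) ?_).trans ?_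
  · intro i j hij
    refine hmono (hb y hy j) (hb y hy i) ?_
    have hy0 : 0 ≤ y := hy.1
    gcongr
  · refine (summable_gaussWeight_mul hx.1 fun i => hf _ (hb y hy i)).tsum_le_tsum (fun i => ?_)
      (summable_gaussWeight_mul hx.1 fun i => hf _ (hb x hx i))
    refine mul_le_mul_of_nonneg_left (hmono (hb y hy i) (hb x hx i) ?_) (gaussWeight_nonneg i hx0)
    gcongr

/-- The transfer operator halves the variation of monotone functions. -/
theorem gaussTransfer_zero_le {f : ℝ → ℝ}
    (hf : ∀ x ∈ Set.Icc (0 : ℝ) 1, f x ∈ Set.Icc (0 : ℝ) 1)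
    (hmono : MonotoneOn f (Set.Icc 0 1)) {c : ℝ} (hc : f 1 ≤ f 0 + c) :
    gaussTransfer f 0 ≤ gaussTransfer f 1 + c / 2 := by
  have hs0 := summable_gaussWeight_mul le_rfl fun i => hf _ (inv_branch_mem_Icc le_rfl i)
  have hR : gaussTransfer f 1 = 2 * ∑' i : ℕ, gaussWeight (i + 1) 0 * f (0 + (i + 1 : ℕ) + 1)⁻¹ := by
    rw [gaussTransfer, ← tsum_mul_left]
    refine tsum_congr fun i => ?_
    have : (1 : ℝ) + i + 1 = 0 + (i + 1 : ℕ) + 1 := by push_cast; ring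
    rw [← this, gaussWeight, gaussWeight]
    push_cast
    ring_nf
  have h0 : gaussTransfer f 0 =
      1 / 2 * f 1 + ∑' i : ℕ, gaussWeight (i + 1) 0 * f (0 + (i + 1 : ℕ) + 1)⁻¹ := by
    rw [gaussTransfer, hs0.tsum_eq_zero_add]
    norm_num [gaussWeight]
  have hw : ∑' i : ℕ, gaussWeight (i + 1) 0 = 1 / 2 := by
    have := (hasSum_gaussWeight le_rfl).summable.tsum_eq_zero_add
    rw [(hasSum_gaussWeight le_rfl).tsum_eq] at this
    norm_num [gaussWeight] at this ⊢
    linarith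
  have hlow : 1 / 2 * f 0 ≤ ∑' i : ℕ, gaussWeight (i + 1) 0 * f (0 + (i + 1 : ℕ) + 1)⁻¹ := by
    rw [← hw, ← tsum_mul_right]
    have hws := (summable_nat_add_iff 1).2 (hasSum_gaussWeight le_rfl).summable
    refine (hws.mul_right _).tsum_le_tsum (fun i => ?_) ((summable_nat_add_iff 1).2 hs0)
    refine mul_le_mul_of_nonneg_left ?_ (gaussWeight_nonneg _ le_rfl)
    have hb := inv_branch_mem_Icc (le_refl (0 : ℝ)) (i + 1)
    exact hmono (by simp) hb hb.1
  rw [hR, h0]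
  linarith

/-- `f` is a `[0, 1]`-valued monotone or antitone function on `[0, 1]` of variation at most `c`. -/
def HasMonoVariation (f : ℝ → ℝ) (c : ℝ) : Prop :=
  (∀ x ∈ Set.Icc (0 : ℝ) 1, f x ∈ Set.Icc (0 : ℝ) 1) ∧
    (MonotoneOn f (Set.Icc 0 1) ∧ f 1 ≤ f 0 + c ∨ AntitoneOn f (Set.Icc 0 1) ∧ f 0 ≤ f 1 + c)

theorem HasMonoVariation.gaussTransfer {f : ℝ → ℝ} {c : ℝ} (h : HasMonoVariation f c) :
    HasMonoVariation (gaussTransfer f) (c / 2) := by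
  obtain ⟨hf, ⟨hm, hc⟩ | ⟨hm, hc⟩⟩ := h
  · exact ⟨fun x hx => gaussTransfer_mem_Icc hf hx.1,
      Or.inr ⟨antitoneOn_gaussTransfer hf hm, gaussTransfer_zero_le hf hm hc⟩⟩
  · refine ⟨fun x hx => gaussTransfer_mem_Icc hf hx.1, Or.inl ?_⟩
    have hf' : ∀ x ∈ Set.Icc (0 : ℝ) 1, 1 - f x ∈ Set.Icc (0 : ℝ) 1 :=
      fun y hy => Set.Icc.mem_iff_one_sub_mem.1 (hf y hy)
    have hm' : MonotoneOn (fun y => 1 - f y) (Set.Icc 0 1) :=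
      fun x hx y hy hxy => sub_le_sub_left (hm hx hy hxy) 1
    constructor
    · intro x hx y hy hxy
      have := antitoneOn_gaussTransfer hf' hm' hx hy hxy
      rw [gaussTransfer_one_sub hf hx.1, gaussTransfer_one_sub hf hy.1] at this
      linarith
    · have := gaussTransfer_zero_le hf' hm' (c := c) (by linarith)
      rw [gaussTransfer_one_sub hf le_rfl, gaussTransfer_one_sub hf zero_le_one] at this
      linarith

theorem HasMonoVariation.iterate_gaussTransfer {f : ℝ → ℝ} {c : ℝ} (h : HasMonoVariation f c)
    (k : ℕ) : HasMonoVariation (_root_.gaussTransfer^[k] f) (c * (1 / 2) ^ k) := by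
  induction k generalizing f c with
  | zero => simpa using h
  | succ k ih =>
    rw [Function.iterate_succ_apply, pow_succ']
    convert ih h.gaussTransfer using 1
    ring

theorem HasMonoVariation.le_add {f : ℝ → ℝ} {c : ℝ} (h : HasMonoVariation f c) {x y : ℝ}
    (hx : x ∈ Set.Icc (0 : ℝ) 1) (hy : y ∈ Set.Icc (0 : ℝ) 1) : f x ≤ f y + c := by
  have h0 : (0 : ℝ) ∈ Set.Icc (0 : ℝ) 1 := by simp
  have h1 : (1 : ℝ) ∈ Set.Icc (0 : ℝ) 1 := by simp
  obtain ⟨-, ⟨hm, hc⟩ | ⟨hm, hc⟩⟩ := h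
  · linarith [hm hx h1 hx.2, hm h0 hy hy.1]
  · linarith [hm h0 hx hx.1, hm hy h1 hy.2]

theorem HasMonoVariation.aemeasurable {f : ℝ → ℝ} {c : ℝ} (h : HasMonoVariation f c)
    (μ : Measure ℝ) : AEMeasurable f (μ.restrict (Set.Icc 0 1)) := by
  obtain ⟨-, ⟨hm, -⟩ | ⟨hm, -⟩⟩ := h
  · exact aemeasurable_restrict_of_monotoneOn measurableSet_Icc hm
  · exact aemeasurable_restrict_of_antitoneOn measurableSet_Icc hm

theorem HasMonoVariation.aemeasurable_comp_branch {f : ℝ → ℝ} {c : ℝ} (h : HasMonoVariation f c)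
    (i : ℕ) (μ : Measure ℝ) :
    AEMeasurable (fun x : ℝ => f (x + i + 1)⁻¹) (μ.restrict (Set.Icc 0 1)) := by
  have hb : AntitoneOn (fun x : ℝ => (x + i + 1)⁻¹) (Set.Icc 0 1) := by
    intro x hx y _ hxy
    have hx0 : 0 ≤ x := hx.1
    dsimp only
    gcongr
  have hmaps : Set.MapsTo (fun x : ℝ => (x + i + 1)⁻¹) (Set.Icc 0 1) (Set.Icc 0 1) :=
    fun x hx => inv_branch_mem_Icc hx.1 i
  obtain ⟨-, ⟨hm, -⟩ | ⟨hm, -⟩⟩ := h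
  · exact aemeasurable_restrict_of_antitoneOn measurableSet_Icc (hm.comp_AntitoneOn hb hmaps)
  · exact aemeasurable_restrict_of_monotoneOn measurableSet_Icc (hm.comp hb hmaps)

theorem measurable_gaussMap : Measurable gaussMap :=
  measurable_fract.comp measurable_inv

theorem gaussMap_mem_Ico (x : ℝ) : gaussMap x ∈ Set.Ico (0 : ℝ) 1 :=
  ⟨Int.fract_nonneg _, Int.fract_lt_one _⟩

theorem gaussMap_branch {u : ℝ} (hu : u ∈ Set.Ico (0 : ℝ) 1) (i : ℕ) :
    gaussMap (u + i + 1)⁻¹ = u := by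
  have : u + i + 1 = u + ((i + 1 : ℕ) : ℝ) := by push_cast; ring
  rw [gaussMap, inv_inv, this, Int.fract_add_natCast, Int.fract_eq_self.2 hu]

theorem Ioc_eq_iUnion_branch :
    Set.Ioc (0 : ℝ) 1 = ⋃ i : ℕ, (fun u : ℝ => (u + i + 1)⁻¹) '' Set.Ico 0 1 := by
  ext y
  simp only [Set.mem_iUnion, Set.mem_image]
  constructor
  · rintro ⟨h0, h1⟩
    have h2 : 1 ≤ y⁻¹ := (one_le_inv₀ h0).2 h1
    have h3 : 1 ≤ ⌊y⁻¹⌋₊ := Nat.le_floor (by simpa using h2)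
    refine ⟨⌊y⁻¹⌋₊ - 1, gaussMap y, gaussMap_mem_Ico y, ?_⟩
    have h4 : gaussMap y + ⌊y⁻¹⌋₊ = y⁻¹ := by
      have h5 := Int.fract_add_floor y⁻¹
      rwa [← natCast_floor_eq_intCast_floor (by positivity)] at h5
    rw [Nat.cast_sub h3, Nat.cast_one, add_assoc, sub_add_cancel, h4, inv_inv]
  · rintro ⟨i, u, ⟨h0, h1⟩, rfl⟩
    exact ⟨by positivity, (inv_branch_mem_Icc h0 i).2⟩

theorem measurableSet_branch (i : ℕ) :
    MeasurableSet ((fun u : ℝ => (u + i + 1)⁻¹) '' Set.Ico 0 1) := by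
  refine measurableSet_Ico.image_of_measurable_injOn (by fun_prop) ?_
  intro u _ v _ h
  simpa using h

theorem pairwise_disjoint_branch :
    Pairwise (Function.onFun Disjoint
      fun i : ℕ => (fun u : ℝ => (u + i + 1)⁻¹) '' Set.Ico (0 : ℝ) 1) := by
  intro i j hij
  refine Set.disjoint_left.2 ?_
  rintro _ ⟨u, hu, rfl⟩ ⟨v, hv, h⟩
  have huv : u = v := by
    rw [← gaussMap_branch hu i, ← gaussMap_branch hv j]
    exact congrArg gaussMap h.symm
  subst huv
  apply hij
  simpa using h.symm

theorem lintegral_gaussMeasure (F : ℝ → ENNReal) :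
    ∫⁻ x, F x ∂gaussMeasure =
      ∫⁻ x in Set.Icc 0 1, ENNReal.ofReal (1 / ((1 + x) * Real.log 2)) * F x := by
  rw [gaussMeasure, lintegral_withDensity_eq_lintegral_mul_non_measurable _ (by fun_prop)
    (ae_of_all _ fun _ => ENNReal.ofReal_lt_top), Measure.restrict_congr_set Ioo_ae_eq_Icc]
  rfl

theorem gaussWeight_mul_density {u : ℝ} (hu : 0 ≤ u) (i : ℕ) :
    |-1 / (u + i + 1) ^ 2| * (1 / ((1 + (u + i + 1)⁻¹) * Real.log 2)) =
      1 / ((1 + u) * Real.log 2) * gaussWeight i u := by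
  have hl : Real.log 2 ≠ 0 := (Real.log_pos one_lt_two).ne'
  have h1 : u + i + 1 ≠ 0 := by positivity
  have h2 : u + i + 2 ≠ 0 := by positivity
  have h3 : 1 + u ≠ 0 := by positivity
  have h4 : 1 + (u + i + 1)⁻¹ = (u + i + 2) / (u + i + 1) := by
    field_simp
    ring
  rw [abs_div, abs_neg, abs_one, abs_of_nonneg (by positivity), h4, gaussWeight]
  field_simp
  ring

/-- Duality between the transfer operator and composition with the Gauss map. -/
theorem lintegral_mul_comp_gaussMap {f : ℝ → ℝ} {c : ℝ} (hf : HasMonoVariation f c)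
    {g : ℝ → ENNReal} (hg : Measurable g) :
    ∫⁻ x, ENNReal.ofReal (f x) * g (gaussMap x) ∂gaussMeasure =
      ∫⁻ x, ENNReal.ofReal (gaussTransfer f x) * g x ∂gaussMeasure := by
  rw [lintegral_gaussMeasure, ← Measure.restrict_congr_set Ioc_ae_eq_Icc, Ioc_eq_iUnion_branch,
    lintegral_iUnion measurableSet_branch pairwise_disjoint_branch, lintegral_gaussMeasure]
  have hbranch : ∀ i : ℕ, ∫⁻ x in (fun u : ℝ => (u + i + 1)⁻¹) '' Set.Ico 0 1,
      ENNReal.ofReal (1 / ((1 + x) * Real.log 2)) * (ENNReal.ofReal (f x) * g (gaussMap x)) =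
      ∫⁻ u in Set.Icc 0 1, ENNReal.ofReal (1 / ((1 + u) * Real.log 2)) *
        (ENNReal.ofReal (gaussWeight i u) * ENNReal.ofReal (f (u + i + 1)⁻¹) * g u) := by
    intro i
    rw [lintegral_image_eq_lintegral_abs_deriv_mul measurableSet_Ico
      (f' := fun u => -1 / (u + i + 1) ^ 2),
      ← Measure.restrict_congr_set Ico_ae_eq_Icc]
    · refine setLIntegral_congr_fun measurableSet_Ico fun u hu => ?_
      have hu0 : 0 ≤ u := hu.1
      have hd : 0 ≤ 1 / ((1 + u) * Real.log 2) := by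
        have := Real.log_pos one_lt_two
        positivity
      simp only [gaussMap_branch hu]
      rw [← mul_assoc, ← ENNReal.ofReal_mul (abs_nonneg _), gaussWeight_mul_density hu0,
        ENNReal.ofReal_mul hd]
      ring
    · intro u hu
      have hu0 : 0 ≤ u := hu.1
      have h1 : u + i + 1 ≠ 0 := by positivity
      exact (((hasDerivAt_id u).add_const (i : ℝ)).add_const 1 |>.inv h1).hasDerivWithinAt
    · intro u _ v _ h
      simpa using h
  simp only [hbranch]
  rw [← lintegral_tsum]
  · refine setLIntegral_congr_fun measurableSet_Icc fun u hu => ?_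
    have hfi := fun i => hf.1 _ (inv_branch_mem_Icc hu.1 i)
    rw [ENNReal.tsum_mul_left, ENNReal.tsum_mul_right, gaussTransfer,
      ENNReal.ofReal_tsum_of_nonneg
        (fun i => mul_nonneg (gaussWeight_nonneg i hu.1) (hfi i).1)
        (summable_gaussWeight_mul hu.1 hfi)]
    simp only [ENNReal.ofReal_mul (gaussWeight_nonneg _ hu.1)]
  · intro i
    have h1 : AEMeasurable (fun u : ℝ => ENNReal.ofReal (1 / ((1 + u) * Real.log 2)))
      (volume.restrict (Set.Icc 0 1)) := by fun_prop
    exact h1.mul (((measurable_gaussWeight i).ennreal_ofReal.aemeasurable.mul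
      (hf.aemeasurable_comp_branch i _).ennreal_ofReal).mul hg.aemeasurable)

theorem lintegral_mul_comp_iterate_gaussMap {f : ℝ → ℝ} {c : ℝ} (hf : HasMonoVariation f c)
    {g : ℝ → ENNReal} (hg : Measurable g) (k : ℕ) :
    ∫⁻ x, ENNReal.ofReal (f x) * g (gaussMap^[k] x) ∂gaussMeasure =
      ∫⁻ x, ENNReal.ofReal (gaussTransfer^[k] f x) * g x ∂gaussMeasure := by
  induction k generalizing f c with
  | zero => rfl
  | succ k ih =>
    simp only [Function.iterate_succ_apply]
    rw [← ih hf.gaussTransfer]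
    exact lintegral_mul_comp_gaussMap hf (hg.comp (measurable_gaussMap.iterate k))

instance isProbabilityMeasure_gaussMeasure : IsProbabilityMeasure gaussMeasure := by
  constructor
  have hl := Real.log_pos one_lt_two
  have hint : ∫ x in (0 : ℝ)..1, 1 / ((1 + x) * Real.log 2) = 1 := by
    have h : ∀ x : ℝ, 1 / ((1 + x) * Real.log 2) = (1 + x)⁻¹ * (Real.log 2)⁻¹ := fun x => by
      rw [one_div, mul_inv]
    simp only [h]
    rw [intervalIntegral.integral_mul_const,
      intervalIntegral.integral_comp_add_left (fun x : ℝ => x⁻¹) 1,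
      integral_inv_of_pos (by norm_num) (by norm_num)]
    norm_num
  have hnn : ∀ x ∈ Set.Ioc (0 : ℝ) 1, 0 ≤ 1 / ((1 + x) * Real.log 2) := fun x hx => by
    have := hx.1
    positivity
  have hcont : ContinuousOn (fun x : ℝ => 1 / ((1 + x) * Real.log 2)) (Set.uIcc 0 1) := by
    intro x hx
    rw [Set.uIcc_of_le zero_le_one] at hx
    have h1 : (1 + x) * Real.log 2 ≠ 0 := by
      have := hx.1
      positivity
    exact ContinuousAt.continuousWithinAt (by fun_prop (disch := assumption))
  rw [← lintegral_one, lintegral_gaussMeasure, ← Measure.restrict_congr_set Ioc_ae_eq_Icc]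
  simp only [mul_one]
  rw [← ofReal_integral_eq_lintegral_ofReal
    ((intervalIntegrable_iff_integrableOn_Ioc_of_le zero_le_one).1 hcont.intervalIntegrable)
    ((ae_restrict_iff' measurableSet_Ioc).2 (ae_of_all _ hnn)),
    ← intervalIntegral.integral_of_le zero_le_one, hint, ENNReal.ofReal_one]

theorem ae_gaussMeasure_mem_Ioo : ∀ᵐ x ∂gaussMeasure, x ∈ Set.Ioo (0 : ℝ) 1 :=
  (withDensity_absolutelyContinuous _ _).ae_le (ae_restrict_mem measurableSet_Ioo)

/-- Exponential mixing of upper sets under the Gauss map. -/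
theorem abs_measureReal_upperSet_inter_sub_le {A : Set ℝ} (hA : IsUpperSet A) {B : Set ℝ}
    (hB : MeasurableSet B) (k : ℕ) :
    |gaussMeasure.real (A ∩ gaussMap^[k] ⁻¹' B) - gaussMeasure.real A * gaussMeasure.real B| ≤
      (1 / 2) ^ k := by
  have hAm : MeasurableSet A := hA.ordConnected.measurableSet
  have hv : HasMonoVariation (A.indicator 1) 1 := by
    refine ⟨fun x _ => ?_, Or.inl ⟨?_, ?_⟩⟩
    · by_cases h : x ∈ A <;> simp [h]
    · intro x _ y _ hxy
      by_cases h : x ∈ A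
      · simp [h, hA hxy h]
      · rw [Set.indicator_of_notMem h]
        exact Set.indicator_nonneg (fun _ _ => zero_le_one) _
    · by_cases h : (1 : ℝ) ∈ A <;> by_cases h' : (0 : ℝ) ∈ A <;> simp [h, h']
  have hind : ∀ s : Set ℝ, ∀ x, ENNReal.ofReal (A.indicator 1 x) * s.indicator 1 x =
      (A ∩ s).indicator 1 x := by
    intro s x
    by_cases h : x ∈ A <;> by_cases h' : x ∈ s <;> simp [h, h']
  set h := gaussTransfer^[k] (A.indicator 1) with hh
  have hvk : HasMonoVariation h ((1 / 2) ^ k) := by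
    simpa using hv.iterate_gaussTransfer k
  have hdual : ∀ s : Set ℝ, MeasurableSet s → gaussMeasure (A ∩ gaussMap^[k] ⁻¹' s) =
      ∫⁻ x in s, ENNReal.ofReal (h x) ∂gaussMeasure := by
    intro s hs
    have hs' : MeasurableSet (A ∩ gaussMap^[k] ⁻¹' s) :=
      hAm.inter ((measurable_gaussMap.iterate k) hs)
    have h1 := lintegral_mul_comp_iterate_gaussMap hv (g := s.indicator 1)
      (measurable_one.indicator hs) k
    rw [← lintegral_indicator_one hs', ← lintegral_indicator hs]
    calc _ = ∫⁻ x, ENNReal.ofReal (A.indicator 1 x) * s.indicator 1 (gaussMap^[k] x)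
          ∂gaussMeasure := lintegral_congr fun x => (hind _ x).symm
      _ = _ := h1
      _ = _ := lintegral_congr fun x => by by_cases hx : x ∈ s <;> simp [hx, hh]
  set c : ENNReal := ENNReal.ofReal ((1 / 2) ^ k) with hc
  have hsum : ∀ x ∈ Set.Ioo (0 : ℝ) 1, ∀ y ∈ Set.Ioo (0 : ℝ) 1,
      ENNReal.ofReal (h x) ≤ ENNReal.ofReal (h y) + c := by
    intro x hx y hy
    rw [hc, ← ENNReal.ofReal_add (hvk.1 y ⟨hy.1.le, hy.2.le⟩).1 (by positivity)]
    exact ENNReal.ofReal_le_ofReal (hvk.le_add ⟨hx.1.le, hx.2.le⟩ ⟨hy.1.le, hy.2.le⟩)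
  have hAint : gaussMeasure A = ∫⁻ x, ENNReal.ofReal (h x) ∂gaussMeasure := by
    simpa using hdual Set.univ MeasurableSet.univ
  have hconst : ∀ b : ENNReal, ∫⁻ _, b ∂gaussMeasure = b := fun b => by simp
  have hup : ∀ x ∈ Set.Ioo (0 : ℝ) 1, ENNReal.ofReal (h x) ≤ gaussMeasure A + c := by
    intro x hx
    rw [hAint, ← hconst (ENNReal.ofReal (h x)), ← hconst c,
      ← lintegral_add_right _ measurable_const]
    refine lintegral_mono_ae ?_
    filter_upwards [ae_gaussMeasure_mem_Ioo] with y hy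
    simpa using hsum x hx y hy
  have hlow : ∀ x ∈ Set.Ioo (0 : ℝ) 1, gaussMeasure A ≤ ENNReal.ofReal (h x) + c := by
    intro x hx
    rw [hAint, ← hconst (ENNReal.ofReal (h x) + c)]
    refine lintegral_mono_ae ?_
    filter_upwards [ae_gaussMeasure_mem_Ioo] with y hy using hsum y hy x hx
  have hB1 : gaussMeasure B ≤ 1 := prob_le_one
  have hupB : gaussMeasure (A ∩ gaussMap^[k] ⁻¹' B) ≤ gaussMeasure A * gaussMeasure B + c := by
    calc _ = ∫⁻ x in B, ENNReal.ofReal (h x) ∂gaussMeasure := hdual B hB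
      _ ≤ ∫⁻ _ in B, (gaussMeasure A + c) ∂gaussMeasure := by
          refine lintegral_mono_ae ?_
          filter_upwards [ae_restrict_of_ae ae_gaussMeasure_mem_Ioo] with y hy using hup y hy
      _ = gaussMeasure A * gaussMeasure B + c * gaussMeasure B := by
          rw [setLIntegral_const, add_mul]
      _ ≤ _ := by gcongr; exact mul_le_of_le_one_right' hB1
  have hlowB : gaussMeasure A * gaussMeasure B ≤ gaussMeasure (A ∩ gaussMap^[k] ⁻¹' B) + c := by
    calc _ = ∫⁻ _ in B, gaussMeasure A ∂gaussMeasure := by rw [setLIntegral_const]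
      _ ≤ ∫⁻ x in B, (ENNReal.ofReal (h x) + c) ∂gaussMeasure := by
          refine lintegral_mono_ae ?_
          filter_upwards [ae_restrict_of_ae ae_gaussMeasure_mem_Ioo] with y hy using hlow y hy
      _ = gaussMeasure (A ∩ gaussMap^[k] ⁻¹' B) + c * gaussMeasure B := by
          rw [lintegral_add_right _ measurable_const, setLIntegral_const, hdual B hB]
      _ ≤ _ := by gcongr; exact mul_le_of_le_one_right' hB1
  have hcr : c.toReal = (1 / 2) ^ k := ENNReal.toReal_ofReal (by positivity)
  have hct : c ≠ ⊤ := ENNReal.ofReal_ne_top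
  have hABt : gaussMeasure A * gaussMeasure B ≠ ⊤ :=
    ENNReal.mul_ne_top (measure_ne_top _ _) (measure_ne_top _ _)
  have h1 := ENNReal.toReal_mono (ENNReal.add_ne_top.2 ⟨hABt, hct⟩) hupB
  have h2 := ENNReal.toReal_mono (ENNReal.add_ne_top.2 ⟨measure_ne_top _ _, hct⟩) hlowB
  rw [ENNReal.toReal_add hABt hct, ENNReal.toReal_mul, hcr] at h1
  rw [ENNReal.toReal_add (measure_ne_top _ _) hct, ENNReal.toReal_mul, hcr] at h2
  simp only [Measure.real]
  rw [abs_le]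
  constructor <;> linarith

theorem measureReal_ordConnected_inter_le {C : Set ℝ} (hC : C.OrdConnected) {B : Set ℝ}
    (hB : MeasurableSet B) (k : ℕ) :
    gaussMeasure.real (C ∩ gaussMap^[k] ⁻¹' B) ≤
      gaussMeasure.real C * gaussMeasure.real B + 2 * (1 / 2) ^ k := by
  let A : Set ℝ := {x | ∃ a ∈ C, a ≤ x}
  have hA : IsUpperSet A := fun x y hxy ⟨z, hz, hzx⟩ => ⟨z, hz, hzx.trans hxy⟩
  have hCA : C ⊆ A := fun x hx => ⟨x, hx, le_rfl⟩
  have hA' : IsUpperSet (A \ C) := by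
    rintro x y hxy ⟨⟨z, hz, hzx⟩, hxC⟩
    exact ⟨⟨z, hz, hzx.trans hxy⟩, fun hy => hxC (hC.out hz hy ⟨hzx, hxy⟩)⟩
  have hCm := hC.measurableSet
  have hkm : MeasurableSet (gaussMap^[k] ⁻¹' B) := (measurable_gaussMap.iterate k) hB
  have h1 := abs_le.1 (abs_measureReal_upperSet_inter_sub_le hA hB k)
  have h2 := abs_le.1 (abs_measureReal_upperSet_inter_sub_le hA' hB k)
  have h3 : gaussMeasure.real (A \ C) = gaussMeasure.real A - gaussMeasure.real C :=
    measureReal_sdiff hCA hCm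
  have h4 : gaussMeasure.real ((A \ C) ∩ gaussMap^[k] ⁻¹' B) =
      gaussMeasure.real (A ∩ gaussMap^[k] ⁻¹' B) -
        gaussMeasure.real (C ∩ gaussMap^[k] ⁻¹' B) := by
    rw [← measureReal_sdiff (Set.inter_subset_inter_left _ hCA) (hCm.inter hkm)]
    congr 1
    ext x
    simp only [Set.mem_inter_iff, Set.mem_sdiff]
    tauto
  rw [h3, h4] at h2
  linarith [h1.2, h2.1]

theorem blockCount_eq_sum (x : ℝ) (m : ℕ) (s : List ℕ) (N : ℕ) :
    (blockCount x m s N : ℝ) =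
      ∑ i ∈ Finset.range (N + 1), (cylinder s).indicator 1 (gaussMap^[m * i] x) := by
  classical
  have h : blockCount x m s N =
      ((Finset.range (N + 1)).filter fun i => gaussMap^[m * i] x ∈ cylinder s).card :=
    Nat.subtype_card _ fun i => by simp
  rw [h, Finset.card_filter]
  push_cast
  rfl

theorem cfDigit_iterate (x : ℝ) (k i : ℕ) : cfDigit (gaussMap^[k] x) i = cfDigit x (i + k) := by
  rw [cfDigit, cfDigit, Function.iterate_add_apply]

theorem iterate_gaussMap_mem_Ico {x : ℝ} (hx : x ∈ Set.Ico (0 : ℝ) 1) (k : ℕ) :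
    gaussMap^[k] x ∈ Set.Ico (0 : ℝ) 1 := by
  cases k with
  | zero => exact hx
  | succ k => rw [Function.iterate_succ_apply']; exact gaussMap_mem_Ico _

theorem mem_Ioo_of_cfDigit_pos {x : ℝ} (hx : x ∈ Set.Ico (0 : ℝ) 1) (h : 0 < cfDigit x 0) :
    x ∈ Set.Ioo (0 : ℝ) 1 := by
  refine ⟨lt_of_le_of_ne hx.1 ?_, hx.2⟩
  rintro rfl
  simp [cfDigit] at h

theorem iterate_mem_cylinder_iff {x : ℝ} (hx : x ∈ Set.Ico (0 : ℝ) 1) {t : List ℕ} (ht : t ≠ [])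
    (hpos : ∀ a ∈ t, 0 < a) (k : ℕ) :
    gaussMap^[k] x ∈ cylinder t ↔ ∀ i < t.length, cfDigit x (i + k) = t.getD i 0 := by
  simp only [_root_.cylinder, Set.mem_ofPred_eq, cfDigit_iterate, and_iff_right_iff_imp]
  intro h
  have h0 : 0 < t.length := List.length_pos_iff.2 ht
  refine mem_Ioo_of_cfDigit_pos (iterate_gaussMap_mem_Ico hx k) ?_
  rw [cfDigit_iterate, h 0 h0, List.getD_eq_getElem _ _ h0]
  exact hpos _ (List.getElem_mem h0)

theorem cfDigit_eq_of_between {w : List ℕ} (hpos : ∀ a ∈ w, 0 < a) {x y z : ℝ}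
    (hx : x ∈ Set.Ico (0 : ℝ) 1) (hz : z ∈ Set.Ico (0 : ℝ) 1) (hxy : x ≤ y) (hyz : y ≤ z)
    (hxw : ∀ i < w.length, cfDigit x i = w.getD i 0)
    (hzw : ∀ i < w.length, cfDigit z i = w.getD i 0) :
    ∀ i < w.length, cfDigit y i = w.getD i 0 := by
  induction w generalizing x y z with
  | nil => simp
  | cons a w ih =>
    have ha : 0 < a := hpos a (by simp)
    have hx0 : cfDigit x 0 = a := by simpa using hxw 0 (by simp)
    have hz0 : cfDigit z 0 = a := by simpa using hzw 0 (by simp)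
    have hxpos : 0 < x := (mem_Ioo_of_cfDigit_pos hx (hx0 ▸ ha)).1
    have hypos := hxpos.trans_le hxy
    have hzpos := hypos.trans_le hyz
    have hyx : y⁻¹ ≤ x⁻¹ := inv_anti₀ hxpos hxy
    have hzy : z⁻¹ ≤ y⁻¹ := inv_anti₀ hypos hyz
    have hy0 : cfDigit y 0 = a :=
      le_antisymm ((Nat.floor_mono hyx).trans_eq hx0) (hz0.symm.trans_le (Nat.floor_mono hzy))
    have hT : ∀ u : ℝ, 0 < u → cfDigit u 0 = a → gaussMap u = u⁻¹ - a := by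
      intro u hu hua
      have h : (⌊u⁻¹⌋₊ : ℝ) = ⌊u⁻¹⌋ := natCast_floor_eq_intCast_floor (by positivity)
      rw [gaussMap, Int.fract, ← h]
      simp [← hua, cfDigit]
    have hstep : ∀ u : ℝ, (∀ i < (a :: w).length, cfDigit u i = (a :: w).getD i 0) →
        ∀ i < w.length, cfDigit (gaussMap u) i = w.getD i 0 :=
      fun u hu i hi => hu (i + 1) (by simpa using hi)
    have key := ih (fun b hb => hpos b (by simp [hb])) (y := gaussMap y)
      (gaussMap_mem_Ico z) (gaussMap_mem_Ico x)
      (by rw [hT z hzpos hz0, hT y hypos hy0]; linarith)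
      (by rw [hT x hxpos hx0, hT y hypos hy0]; linarith) (hstep z hzw) (hstep x hxw)
    intro i hi
    cases i with
    | zero => simpa using hy0
    | succ i => exact key i (by simpa using hi)

theorem ordConnected_cylinder {w : List ℕ} (hpos : ∀ a ∈ w, 0 < a) :
    (cylinder w).OrdConnected := by
  refine ⟨fun x hx z hz y hy => ⟨⟨hx.1.1.trans_le hy.1, hy.2.trans_lt hz.1.2⟩, ?_⟩⟩
  exact cfDigit_eq_of_between hpos (Set.Ioo_subset_Ico_self hx.1) (Set.Ioo_subset_Ico_self hz.1)
    hy.1 hy.2 hx.2 hz.2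

theorem eq_of_mem_cylinder {w w' : List ℕ} (hlen : w.length = w'.length) {y : ℝ}
    (hy : y ∈ cylinder w) (hy' : y ∈ cylinder w') : w = w' := by
  refine List.ext_getElem hlen fun i h1 h2 => ?_
  rw [← List.getD_eq_getElem _ 0 h1, ← List.getD_eq_getElem _ 0 h2, ← hy.2 i h1, ← hy'.2 i h2]

theorem cfDigit_pos_of_irrational {x : ℝ} (hx : x ∈ Set.Ioo (0 : ℝ) 1) (hirr : Irrational x)
    (i : ℕ) : 0 < cfDigit x i := by
  have h : Irrational (gaussMap^[i] x) ∧ gaussMap^[i] x ∈ Set.Ioo (0 : ℝ) 1 := by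
    induction i with
    | zero => exact ⟨hirr, hx⟩
    | succ i ih =>
      rw [Function.iterate_succ_apply']
      have h1 : Irrational (gaussMap (gaussMap^[i] x)) := ih.1.inv.sub_intCast _
      exact ⟨h1, lt_of_le_of_ne (gaussMap_mem_Ico _).1 h1.ne_zero.symm, (gaussMap_mem_Ico _).2⟩
  exact Nat.floor_pos.2 ((one_le_inv₀ h.2.1).2 h.2.2.le)

theorem ae_gaussMeasure_irrational : ∀ᵐ x ∂gaussMeasure, Irrational x := by
  have h : ∀ᵐ x : ℝ, Irrational x := by
    rw [ae_iff]
    have h1 := (Set.countable_range ((↑) : ℚ → ℝ)).measure_zero volume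
    convert h1 using 2
    ext x
    simp [Irrational]
  exact (withDensity_absolutelyContinuous _ _).ae_le (ae_restrict_of_ae h)

theorem indicator_one_mem_Icc (s : Set ℝ) (y : ℝ) : s.indicator 1 y ∈ Set.Icc (0 : ℝ) 1 := by
  by_cases h : y ∈ s <;> simp [h]

theorem tendsto_div_natCast_zero {e : ℕ → ℝ} {M : ℝ} (he : ∀ n, |e n| ≤ M) :
    Tendsto (fun n : ℕ => e n / n) atTop (nhds 0) := by
  refine squeeze_zero_norm (fun n => ?_) (tendsto_const_div_atTop_nhds_zero_nat M)
  rw [Real.norm_eq_abs, abs_div, Nat.abs_cast]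
  gcongr
  exact he n

theorem CFNormal.tendsto_average {x : ℝ} (hx : CFNormal x) {s : List ℕ} (hs : s ≠ [])
    (hpos : ∀ a ∈ s, 0 < a) :
    Tendsto (fun n : ℕ =>
      (∑ j ∈ Finset.range n, (cylinder s).indicator (1 : ℝ → ℝ) (gaussMap^[j] x)) / n) atTop
      (nhds (gaussMeasure.real (cylinder s))) := by
  have h1 : Tendsto (fun n : ℕ => (cylinder s).indicator (1 : ℝ → ℝ) (gaussMap^[n] x) / n) atTop
      (nhds 0) := tendsto_div_natCast_zero (M := 1) fun n => by
    have := indicator_one_mem_Icc (cylinder s) (gaussMap^[n] x)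
    rw [abs_of_nonneg this.1]
    exact this.2
  have h2 := (hx s hs hpos).sub h1
  rw [sub_zero] at h2
  refine h2.congr fun n => ?_
  rw [blockCount_eq_sum, ← sub_div, Finset.sum_range_succ]
  simp

/-- The orbit of a normal number visits a set determined by finitely many digits at most as often
as the Gauss measure predicts. -/
theorem CFNormal.eventuallyLeLinear_visits {x : ℝ} (hx : CFNormal x) {E : Set ℝ} {L : ℕ}
    (hL : 0 < L) (hE : ∀ y ∈ Set.Ioo (0 : ℝ) 1, ∀ z ∈ E,
      (∀ i < L, cfDigit z i = cfDigit y i) → y ∈ E) :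
    EventuallyLeLinear (fun n => ∑ j ∈ Finset.range n, E.indicator 1 (gaussMap^[j] x))
      (gaussMeasure.real E) := by
  classical
  set W : Set (List ℕ) := {w | (∀ a ∈ w, 0 < a) ∧ w.length = L ∧ Disjoint (cylinder w) E}
  have hcover : (1 : ENNReal) ≤ gaussMeasure E + ∑' w : W, gaussMeasure (cylinder w) := by
    calc (1 : ENNReal) = gaussMeasure Set.univ := measure_univ.symm
      _ ≤ gaussMeasure (E ∪ ⋃ w : W, cylinder w) := by
          refine measure_mono_ae ?_
          filter_upwards [ae_gaussMeasure_mem_Ioo, ae_gaussMeasure_irrational] with y hy hirr _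
          by_cases hyE : y ∈ E
          · exact Or.inl hyE
          refine Or.inr (Set.mem_iUnion.2 ⟨⟨(List.range L).map (cfDigit y), ?_, by simp, ?_⟩, ?_⟩)
          · intro a ha
            obtain ⟨i, -, rfl⟩ := List.mem_map.1 ha
            exact cfDigit_pos_of_irrational hy hirr i
          · refine Set.disjoint_left.2 fun z hz hzE => hyE (hE y hy z hzE fun i hi => ?_)
            rw [hz.2 i (by simpa using hi)]
            simp [hi]
          · refine ⟨hy, fun i hi => ?_⟩
            have hi' : i < L := by simpa using hi
            simp [hi']
      _ ≤ _ := (measure_union_le _ _).trans (by gcongr; exact measure_iUnion_le _)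
  intro δ hδ
  have hlt : ENNReal.ofReal (1 - δ / 2) < gaussMeasure E + ∑' w : W, gaussMeasure (cylinder w) := by
    refine lt_of_lt_of_le ?_ hcover
    rw [ENNReal.ofReal_lt_one]
    linarith
  have htend : Tendsto (fun F : Finset W => gaussMeasure E + ∑ w ∈ F, gaussMeasure (cylinder w))
      atTop (nhds (gaussMeasure E + ∑' w : W, gaussMeasure (cylinder w))) :=
    tendsto_const_nhds.add ENNReal.summable.hasSum
  obtain ⟨F, hF⟩ := (htend.eventually_const_lt hlt).exists
  have hF' : 1 - ∑ w ∈ F, gaussMeasure.real (cylinder w) ≤ gaussMeasure.real E + δ / 2 := by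
    have hsum : ∑ w ∈ F, gaussMeasure (cylinder w) ≠ ⊤ :=
      ENNReal.sum_ne_top.2 fun w _ => measure_ne_top _ _
    have h := (ENNReal.ofReal_le_iff_le_toReal
      (ENNReal.add_ne_top.2 ⟨measure_ne_top _ _, hsum⟩)).1 hF.le
    rw [ENNReal.toReal_add (measure_ne_top _ _) hsum,
      ENNReal.toReal_sum fun w _ => measure_ne_top _ _] at h
    simp only [Measure.real]
    linarith
  have hpt : ∀ y : ℝ, E.indicator (1 : ℝ → ℝ) y ≤
      1 - ∑ w ∈ F, (cylinder (w : List ℕ)).indicator (1 : ℝ → ℝ) y := by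
    intro y
    by_cases hy : ∃ w ∈ F, y ∈ cylinder (w : List ℕ)
    · obtain ⟨w, hwF, hw⟩ := hy
      have hyE : y ∉ E := Set.disjoint_left.1 w.2.2.2 hw
      rw [Finset.sum_eq_single_of_mem w hwF fun v _ hvw => ?_]
      · simp [hyE, hw]
      · refine Set.indicator_of_notMem (fun hv => hvw ?_) _
        exact Subtype.ext (eq_of_mem_cylinder (v.2.2.1.trans w.2.2.1.symm) hv hw)
    · push Not at hy
      rw [Finset.sum_eq_zero fun w hw => Set.indicator_of_notMem (hy w hw) _, sub_zero]
      exact (indicator_one_mem_Icc E y).2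
  have hlim : Tendsto (fun n : ℕ => ((n : ℝ) - ∑ w ∈ F, ∑ j ∈ Finset.range n,
      (cylinder (w : List ℕ)).indicator (1 : ℝ → ℝ) (gaussMap^[j] x)) / n) atTop
      (nhds (1 - ∑ w ∈ F, gaussMeasure.real (cylinder w))) := by
    have h1 := tendsto_finsetSum F fun w _ =>
      hx.tendsto_average (s := w) (by rintro h; have := w.2.2.1; simp [h] at this; omega) w.2.1
    refine (h1.const_sub 1).congr' ?_
    filter_upwards [eventually_gt_atTop 0] with n hn
    have hn' : (n : ℝ) ≠ 0 := by positivity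
    rw [sub_div, div_self hn', Finset.sum_div]
  refine (EventuallyLeLinear.of_tendsto hlim |>.mono (fun n => ?_) hF' (δ / 2) (half_pos hδ)).mono
    fun n hn => hn.trans_eq (by ring)
  refine (Finset.sum_le_sum fun j _ => hpt _).trans_eq ?_
  rw [Finset.sum_sub_distrib, Finset.sum_comm]
  simp

theorem CFNormal.eventuallyLeLinear_correlation {x : ℝ} (hnormal : CFNormal x) {t : List ℕ}
    (ht : t ≠ []) (hpos : ∀ a ∈ t, 0 < a) (k : ℕ) :
    EventuallyLeLinear (fun n => ∑ j ∈ Finset.range n,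
      ((cylinder t).indicator 1 (gaussMap^[j] x) - gaussMeasure.real (cylinder t)) *
        ((cylinder t).indicator 1 (gaussMap^[j + k] x) - gaussMeasure.real (cylinder t)))
      (2 * (1 / 2) ^ k) := by
  set C := cylinder t
  set p := gaussMeasure.real C with hp
  set b : ℕ → ℝ := fun j => C.indicator 1 (gaussMap^[j] x) with hb
  have hord : C.OrdConnected := ordConnected_cylinder hpos
  have hb1 : ∀ j, |b j| ≤ 1 := fun j => by
    have := indicator_one_mem_Icc C (gaussMap^[j] x)
    rw [abs_of_nonneg this.1]
    exact this.2
  have hvisits := hnormal.eventuallyLeLinear_visits (E := C ∩ gaussMap^[k] ⁻¹' C)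
    (L := t.length + k) (by have := List.length_pos_iff.2 ht; omega) (by
      rintro y hy z ⟨hz, hzk⟩ hyz
      refine ⟨⟨hy, fun i hi => ?_⟩, ?_⟩
      · rw [← hyz i (by omega), hz.2 i hi]
      · rw [Set.mem_preimage, iterate_mem_cylinder_iff (Set.Ioo_subset_Ico_self hz.1) ht hpos] at hzk
        rw [Set.mem_preimage, iterate_mem_cylinder_iff (Set.Ioo_subset_Ico_self hy) ht hpos]
        intro i hi
        rw [← hyz _ (by omega), hzk i hi])
  have hprod : ∀ j, (C ∩ gaussMap^[k] ⁻¹' C).indicator (1 : ℝ → ℝ) (gaussMap^[j] x) =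
      b j * b (j + k) := by
    intro j
    have h1 : b (j + k) = (gaussMap^[k] ⁻¹' C).indicator 1 (gaussMap^[j] x) := by
      rw [hb, add_comm j k]
      simp only [Function.iterate_add_apply]
      rfl
    rw [h1, Set.inter_indicator_one]
    rfl
  simp only [hprod] at hvisits
  have hav : Tendsto (fun n : ℕ => (∑ j ∈ Finset.range n, b j) / n) atTop (nhds p) :=
    hnormal.tendsto_average ht hpos
  have havk : Tendsto (fun n : ℕ => (∑ j ∈ Finset.range n, b (j + k)) / n) atTop (nhds p) := by
    have h := (tendsto_div_natCast_zero (abs_sum_range_shift_sub_le hb1 k)).add hav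
    rw [zero_add] at h
    refine h.congr fun n => ?_
    rw [← add_div]
    ring
  have hrest : EventuallyLeLinear (fun n => n * p ^ 2 -
      p * ∑ j ∈ Finset.range n, b j - p * ∑ j ∈ Finset.range n, b (j + k)) (-p ^ 2) := by
    refine .of_tendsto ?_
    have h := ((tendsto_const_nhds (x := p ^ 2)).sub (hav.const_mul p)).sub (havk.const_mul p)
    rw [show p ^ 2 - p * p - p * p = -p ^ 2 by ring] at h
    refine h.congr' ?_
    filter_upwards [eventually_gt_atTop 0] with n hn
    have hn' : (n : ℝ) ≠ 0 := by positivity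
    field_simp
  refine (hvisits.add hrest).mono (fun n => le_of_eq ?_) ?_
  · simp only [sub_mul, mul_sub, Finset.sum_sub_distrib, ← Finset.mul_sum, ← Finset.sum_mul,
      Finset.sum_const, Finset.card_range, nsmul_eq_mul, hb]
    ring
  · have := measureReal_ordConnected_inter_le hord hord.measurableSet k
    rw [← hp] at this
    linarith
theorem pillai_converse (x : ℝ) (hx : x ∈ Set.Ioo (0:ℝ) 1)
    (hover : ∀ s : List ℕ, s ≠ [] → (∀ a ∈ s, 0 < a) →
      Tendsto (fun n : ℕ => (blockCount x 1 s n : ℝ) / n) atTop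
        (nhds (gaussMeasure (cylinder s)).toReal)) :
    ∀ t : List ℕ, t ≠ [] → (∀ a ∈ t, 0 < a) →
      Tendsto (fun n : ℕ => (blockCount x t.length t (n / t.length) : ℝ) /
          ((n : ℝ) / t.length)) atTop (nhds (gaussMeasure (cylinder t)).toReal) := by
  intro t ht hpos
  have hm : 0 < t.length := List.length_pos_iff.2 ht
  have hm' : (0 : ℝ) < t.length := by exact_mod_cast hm
  set p := gaussMeasure.real (cylinder t)
  set b : ℕ → ℝ := fun j => (cylinder t).indicator 1 (gaussMap^[j] x)
  have hc : ∀ j, |b j - p| ≤ 1 := by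
    intro j
    have h1 := indicator_one_mem_Icc (cylinder t) (gaussMap^[j] x)
    have h2 : 0 ≤ p := measureReal_nonneg
    have h3 : p ≤ 1 := measureReal_le_one
    rw [abs_le]
    constructor <;> linarith [h1.1, h1.2]
  have hM : ∀ K, ∑ d ∈ Finset.range K, 2 * (1 / 2 : ℝ) ^ d ≤ 4 := fun K => by
    rw [← Finset.mul_sum]
    linarith [sum_geometric_two_le K]
  have hzero := tendsto_average_mul_zero hc hm hM fun d =>
    (CFNormal.eventuallyLeLinear_correlation hover ht hpos (t.length * d)).mono
      (fun n => le_rfl) (by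
        gcongr 2 * ?_
        exact pow_le_pow_of_le_one (by norm_num) (by norm_num) (Nat.le_mul_of_pos_left d hm))
  have hav : Tendsto (fun N : ℕ => (∑ i ∈ Finset.range N, b (t.length * i)) / N) atTop
      (nhds p) := by
    have h := hzero.add_const p
    rw [zero_add] at h
    refine h.congr' ?_
    filter_upwards [eventually_gt_atTop 0] with N hN
    have hN' : (N : ℝ) ≠ 0 := by positivity
    rw [Finset.sum_sub_distrib]
    simp only [Finset.sum_const, Finset.card_range, nsmul_eq_mul]
    field_simp
    ring
  have hdiv : Tendsto (fun n : ℕ => (n : ℝ) / t.length) atTop atTop :=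
    tendsto_natCast_atTop_atTop.atTop_div_const hm'
  have hratio : Tendsto (fun n : ℕ => ((n / t.length + 1 : ℕ) : ℝ) / ((n : ℝ) / t.length)) atTop
      (nhds 1) := by
    have h := (tendsto_nat_floor_div_atTop.comp hdiv).add (tendsto_inv_atTop_zero.comp hdiv)
    rw [add_zero] at h
    refine h.congr fun n => ?_
    simp only [Function.comp_apply, Nat.floor_div_eq_div]
    rw [inv_eq_one_div, ← add_div]
    push_cast
    rfl
  have hN : Tendsto (fun n : ℕ => n / t.length + 1) atTop atTop :=
    (tendsto_add_atTop_nat 1).comp (Nat.tendsto_div_const_atTop hm.ne')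
  have h := (hav.comp hN).mul hratio
  rw [mul_one] at h
  refine h.congr fun n => ?_
  have hN' : ((n / t.length + 1 : ℕ) : ℝ) ≠ 0 := by positivity
  rw [blockCount_eq_sum, Function.comp_apply, div_mul_div_cancel₀ hN']
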